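/- There is no group homomorphism Φ : G_o → ℝ such that Φ(h) = σ(h) for every h ∈ G_o restricting to the identity on ∂D; that is, the flux homomorphism Flux_ℝ : G_{o,rel} → ℝ cannot be extended to a group homomorphism on G_o. -/

import Mathlib

open MeasureTheory Filter Topology Set Function Real

noncomputable section

/-- The closed unit disk in `ℝ²`. -/
def disk : Set (ℝ × ℝ) := {p | p.1 ^ 2 + p.2 ^ 2 ≤ 1}

/-- The boundary circle of the unit disk. -/
def bdry : Set (ℝ × ℝ) := {p | p.1 ^ 2 + p.2 ^ 2 = 1}

/-- Partial derivative in the `x`-direction. -/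
def pdx (f : ℝ × ℝ → ℝ) (p : ℝ × ℝ) : ℝ := fderiv ℝ f p (1, 0)

/-- Partial derivative in the `y`-direction. -/
def pdy (f : ℝ × ℝ → ℝ) (p : ℝ × ℝ) : ℝ := fderiv ℝ f p (0, 1)

/-- The Jacobian determinant of a map `ℝ² → ℝ²`. -/
def jacDet (g : ℝ × ℝ → ℝ × ℝ) (p : ℝ × ℝ) : ℝ :=
  pdx (fun q => (g q).1) p * pdy (fun q => (g q).2) p -
    pdy (fun q => (g q).1) p * pdx (fun q => (g q).2) p

/-- `g` represents an element of `Symp(D)`: a `C^∞` diffeomorphism of the closed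
unit disk onto itself (smooth up to the boundary, i.e. the restriction of a
globally smooth map with globally smooth inverse on the disk) whose Jacobian
determinant is identically `1` on the disk. -/
def IsSymp (g : ℝ × ℝ → ℝ × ℝ) : Prop :=
  ContDiff ℝ (⊤ : ℕ∞) g ∧ MapsTo g disk disk ∧ (∀ p ∈ disk, jacDet g p = 1) ∧
    ∃ g' : ℝ × ℝ → ℝ × ℝ, ContDiff ℝ (⊤ : ℕ∞) g' ∧ MapsTo g' disk disk ∧
      (∀ p ∈ disk, g' (g p) = p) ∧ (∀ p ∈ disk, g (g' p) = p)

/-- `g` represents an element of `G_o`: a symplectomorphism of the disk fixing the origin. -/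
def IsSympO (g : ℝ × ℝ → ℝ × ℝ) : Prop :=
  IsSymp g ∧ g (0, 0) = (0, 0)

/-- `τ_λ(g) = ∫_D g*λ ∧ λ` for `λ = (x dy - y dx)/2`, written out in coordinates. -/
def tauL (g : ℝ × ℝ → ℝ × ℝ) : ℝ :=
  (1 / 4) * ∫ p in disk,
    (p.1 * ((g p).1 * pdx (fun q => (g q).2) p - (g p).2 * pdx (fun q => (g q).1) p) +
     p.2 * ((g p).1 * pdy (fun q => (g q).2) p - (g p).2 * pdy (fun q => (g q).1) p))

/-- `σ(g) = ∫_γ (g*λ - λ)` along the radial path `γ(t) = (t,0)`, in coordinates. -/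
def sigmaQ (g : ℝ × ℝ → ℝ × ℝ) : ℝ :=
  (1 / 2) * ∫ t in (0:ℝ)..1,
    ((g (t, 0)).1 * pdx (fun q => (g q).2) (t, 0) -
      (g (t, 0)).2 * pdx (fun q => (g q).1) (t, 0))

/-- `G` is a smooth isotopy in `Symp(D)` starting at the identity. -/
def IsIsotopy (G : ℝ → ℝ × ℝ → ℝ × ℝ) : Prop :=
  ContDiff ℝ (⊤ : ℕ∞) (fun q : ℝ × (ℝ × ℝ) => G q.1 q.2) ∧
    (∀ t ∈ Icc (0:ℝ) 1, IsSymp (G t)) ∧ (∀ p ∈ disk, G 0 p = p)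

/-- `f` is a family of Hamiltonian functions for the isotopy `G`, i.e.
`i_{X_t} ω = d f_t` where `X_t = (∂g_t/∂t) ∘ g_t⁻¹`; since `g_t` maps the disk
onto itself this is expressed at the points `G t p`, `p ∈ D`. -/
def IsHam (G : ℝ → ℝ × ℝ → ℝ × ℝ) (f : ℝ → ℝ × ℝ → ℝ) : Prop :=
  ContDiff ℝ (⊤ : ℕ∞) (fun q : ℝ × (ℝ × ℝ) => f q.1 q.2) ∧
    ∀ t ∈ Icc (0:ℝ) 1, ∀ p ∈ disk,
      pdx (f t) (G t p) = -(deriv (fun s => G s p) t).2 ∧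
      pdy (f t) (G t p) = (deriv (fun s => G s p) t).1

/-- `φ` is the lift of the boundary isotopy of `G`, with `φ 0 = id`. -/
def IsBoundaryLift (G : ℝ → ℝ × ℝ → ℝ × ℝ) (φ : ℝ → ℝ → ℝ) : Prop :=
  ContDiff ℝ (⊤ : ℕ∞) (fun q : ℝ × ℝ => φ q.1 q.2) ∧
    (∀ t ∈ Icc (0:ℝ) 1, StrictMono (φ t) ∧ ∀ θ : ℝ, φ t (θ + 2 * π) = φ t θ + 2 * π) ∧
    (∀ θ : ℝ, φ 0 θ = θ) ∧
    (∀ t ∈ Icc (0:ℝ) 1, ∀ θ : ℝ,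
      G t (Real.cos θ, Real.sin θ) = (Real.cos (φ t θ), Real.sin (φ t θ)))


/-- twice the standard primitive of the area form -/
def lam (z v : ℝ × ℝ) : ℝ := z.1 * v.2 - z.2 * v.1

/-- rotation -/
def rot (a : ℝ) (p : ℝ × ℝ) : ℝ × ℝ :=
  (cos a * p.1 - sin a * p.2, sin a * p.1 + cos a * p.2)

/-- bilinear version of `lam` -/
def lamL : (ℝ × ℝ) →L[ℝ] (ℝ × ℝ) →L[ℝ] ℝ :=
  (ContinuousLinearMap.fst ℝ ℝ ℝ).smulRight (ContinuousLinearMap.snd ℝ ℝ ℝ) -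
  (ContinuousLinearMap.snd ℝ ℝ ℝ).smulRight (ContinuousLinearMap.fst ℝ ℝ ℝ)

lemma lamL_apply (z v : ℝ × ℝ) : lamL z v = lam z v := by
  simp [lamL, lam]

lemma rot_rot (a b : ℝ) (p : ℝ × ℝ) : rot a (rot b p) = rot (a + b) p := by
  simp only [rot, cos_add, sin_add]; ext <;> simp <;> ring

lemma rot_zero (p : ℝ × ℝ) : rot 0 p = p := by
  simp [rot]

lemma rot_sq (a : ℝ) (p : ℝ × ℝ) :
    (rot a p).1 ^ 2 + (rot a p).2 ^ 2 = p.1 ^ 2 + p.2 ^ 2 := by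
  simp only [rot]; linear_combination (p.1 ^ 2 + p.2 ^ 2) * sin_sq_add_cos_sq a

structure Good (g : Equiv.Perm (ℝ × ℝ)) (c : ℝ) : Prop where
  sm : ContDiff ℝ (⊤ : ℕ∞) g
  smi : ContDiff ℝ (⊤ : ℕ∞) g.symm
  dsk : ∀ p, g p ∈ disk ↔ p ∈ disk
  zero : g (0, 0) = (0, 0)
  ex : ∃ F : ℝ × ℝ → ℝ, ContDiff ℝ (⊤ : ℕ∞) F ∧ F (0, 0) = 0 ∧
    (∀ z v, lam (g z) (fderiv ℝ g z v) = lam z v + fderiv ℝ F z v) ∧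
    ∀ p ∈ bdry, g p = rot (F p - c) p

lemma rot_mem_bdry {a : ℝ} {p : ℝ × ℝ} (hp : p ∈ bdry) : rot a p ∈ bdry := by
  simp only [bdry, mem_ofPred_eq] at *; rw [rot_sq, hp]

lemma Good.bd {g : Equiv.Perm (ℝ × ℝ)} {c : ℝ} (h : Good g c) {p : ℝ × ℝ} (hp : p ∈ bdry) :
    g p ∈ bdry := by
  obtain ⟨F, -, -, -, h4⟩ := h.ex
  rw [h4 p hp]; exact rot_mem_bdry hp

lemma Good.mul {g h : Equiv.Perm (ℝ × ℝ)} {c d : ℝ} (hg : Good g c) (hh : Good h d) :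
    Good (g * h) (c + d) := by
  obtain ⟨F, F1, F2, F3, F4⟩ := hg.ex
  obtain ⟨K, K1, K2, K3, K4⟩ := hh.ex
  refine ⟨hg.sm.comp hh.sm, hh.smi.comp hg.smi, fun p => (hg.dsk _).trans (hh.dsk _), ?_, 
    fun z => F (h z) + K z, (F1.comp hh.sm).add K1, ?_, ?_, ?_⟩
  · simp [hh.zero, hg.zero]
  · simp [hh.zero, F2, K2]
  · intro z v
    have dh : DifferentiableAt ℝ h z := hh.sm.differentiable (by simp) z
    have dg : DifferentiableAt ℝ g (h z) := hg.sm.differentiable (by simp) _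
    have dF : DifferentiableAt ℝ F (h z) := F1.differentiable (by simp) _
    have dK : DifferentiableAt ℝ K z := K1.differentiable (by simp) _
    have e1 : fderiv ℝ (g * h : Equiv.Perm (ℝ × ℝ)) z = (fderiv ℝ g (h z)).comp (fderiv ℝ h z) :=
      fderiv_comp z dg dh
    have e2 : fderiv ℝ (fun z => F (h z) + K z) z =
        (fderiv ℝ F (h z)).comp (fderiv ℝ h z) + fderiv ℝ K z :=
      ((dF.hasFDerivAt.comp z dh.hasFDerivAt).add dK.hasFDerivAt).fderiv
    rw [e1, e2]
    simp only [Equiv.Perm.mul_apply, ContinuousLinearMap.comp_apply, add_apply]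
    rw [F3, K3]; ring
  · intro p hp
    have := hh.bd hp
    rw [Equiv.Perm.mul_apply, F4 _ this]
    rw [show rot (F (h p) - c) (h p) = rot (F (h p) - c) (rot (K p - d) p) by rw [← K4 p hp]]
    rw [rot_rot]; congr 1; ring

lemma Good.inv_bd {g : Equiv.Perm (ℝ × ℝ)} {c : ℝ} (h : Good g c) {p : ℝ × ℝ} (hp : p ∈ bdry) :
    g.symm p ∈ bdry := by
  -- the interior of the disk is mapped into the interior, by openness
  by_contra hq
  set q := g.symm p with hqdef
  have hgq : g q = p := by simp [hqdef]
  have hpd : p ∈ disk := by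
    simp only [disk, bdry, mem_ofPred_eq] at *; exact hp.le
  have hqd : q ∈ disk := by rw [← h.dsk, hgq]; exact hpd
  have hlt : q.1 ^ 2 + q.2 ^ 2 < 1 := by
    simp only [disk, bdry, mem_ofPred_eq] at *; exact lt_of_le_of_ne hqd hq
  have hev : ∀ᶠ z in 𝓝 q, z.1 ^ 2 + z.2 ^ 2 < 1 := by
    have : Continuous fun z : ℝ × ℝ => z.1 ^ 2 + z.2 ^ 2 := by fun_prop
    exact this.continuousAt.eventually_lt continuousAt_const hlt
  have hc : Tendsto (fun t : ℝ => g.symm (t • p)) (𝓝 1) (𝓝 q) := by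
    have : Continuous fun t : ℝ => g.symm (t • p) := h.smi.continuous.comp (by fun_prop)
    simpa [hqdef] using this.tendsto 1
  have h3 := (hc.eventually hev).filter_mono (nhdsWithin_le_nhds (s := Ioi 1))
  obtain ⟨t, ht, ht1⟩ := (h3.and self_mem_nhdsWithin).exists
  have ht1 : 1 < t := ht1
  have : g.symm (t • p) ∈ disk := by simp only [disk, mem_ofPred_eq]; exact ht.le
  rw [← h.dsk, Equiv.apply_symm_apply] at this
  simp only [disk, bdry, mem_ofPred_eq, Prod.smul_fst, Prod.smul_snd, smul_eq_mul] at *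
  have e : (t * p.1) ^ 2 + (t * p.2) ^ 2 = t ^ 2 := by linear_combination t ^ 2 * hp
  nlinarith

lemma Good.inv {g : Equiv.Perm (ℝ × ℝ)} {c : ℝ} (hg : Good g c) : Good g⁻¹ (-c) := by
  obtain ⟨F, F1, F2, F3, F4⟩ := hg.ex
  have hz : g.symm (0, 0) = (0, 0) := by rw [Equiv.symm_apply_eq, hg.zero]
  refine ⟨hg.smi, hg.sm, fun p => ?_, hz, fun z => - F (g.symm z), (F1.comp hg.smi).neg, ?_, ?_, ?_⟩
  · rw [← hg.dsk]; simp
  · simp [hz, F2]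
  · intro z v
    have dh : DifferentiableAt ℝ g.symm z := hg.smi.differentiable (by simp) z
    have dg : DifferentiableAt ℝ g (g.symm z) := hg.sm.differentiable (by simp) _
    have dF : DifferentiableAt ℝ F (g.symm z) := F1.differentiable (by simp) _
    have e1 : (fderiv ℝ g (g.symm z)).comp (fderiv ℝ g.symm z) = ContinuousLinearMap.id ℝ _ := by
      rw [← fderiv_comp z dg dh]; simp
    have e2 : fderiv ℝ (fun z => - F (g.symm z)) z =
        -(fderiv ℝ F (g.symm z)).comp (fderiv ℝ g.symm z) :=
      (dF.hasFDerivAt.comp z dh.hasFDerivAt).neg.fderiv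
    have e3 := F3 (g.symm z) (fderiv ℝ g.symm z v)
    have e4 : fderiv ℝ g (g.symm z) (fderiv ℝ g.symm z v) = v := by
      have := congrArg (fun L => L v) e1
      simpa using this
    rw [e4, Equiv.apply_symm_apply] at e3
    rw [e2]
    simp only [neg_apply, ContinuousLinearMap.comp_apply]
    change lam (g.symm z) (fderiv ℝ g.symm z v) = _
    rw [e3]; ring
  · intro p hp
    have h1 := F4 _ (hg.inv_bd hp)
    rw [Equiv.apply_symm_apply] at h1
    change g.symm p = _
    conv_rhs => rw [h1]
    rw [rot_rot]
    conv_lhs => rw [← rot_zero (g.symm p)]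
    congr 1
    rw [← h1]; ring

lemma Good.jac {g : Equiv.Perm (ℝ × ℝ)} {c : ℝ} (hg : Good g c) (z : ℝ × ℝ) : jacDet g z = 1 := by
  obtain ⟨F, F1, F2, F3, F4⟩ := hg.ex
  have dg : DifferentiableAt ℝ g z := hg.sm.differentiable (by simp) z
  have dg' : DifferentiableAt ℝ (fderiv ℝ g) z :=
    (hg.sm.fderiv_right (m := (⊤ : ℕ∞)) (by simp)).differentiable (by simp) z
  have dF' : DifferentiableAt ℝ (fderiv ℝ F) z :=
    (F1.fderiv_right (m := (⊤ : ℕ∞)) (by simp)).differentiable (by simp) z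
  have sg : IsSymmSndFDerivAt ℝ g z := hg.sm.contDiffAt.isSymmSndFDerivAt
    (by simp only [minSmoothness_of_isRCLikeNormedField]; exact WithTop.coe_le_coe.2 (le_top : (2 : ℕ∞) ≤ ⊤))
  have sF : IsSymmSndFDerivAt ℝ F z := F1.contDiffAt.isSymmSndFDerivAt
    (by simp only [minSmoothness_of_isRCLikeNormedField]; exact WithTop.coe_le_coe.2 (le_top : (2 : ℕ∞) ≤ ⊤))
  have key : ∀ v w, lam (fderiv ℝ g z w) (fderiv ℝ g z v) +
      lam (g z) (fderiv ℝ (fderiv ℝ g) z w v) = lam w v + fderiv ℝ (fderiv ℝ F) z w v := by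
    intro v w
    have l1 : HasFDerivAt (fun y => lamL (g y) (fderiv ℝ g y v)) _ z :=
      (lamL.hasFDerivAt.comp z dg.hasFDerivAt).clm_apply
        (dg'.hasFDerivAt.clm_apply (hasFDerivAt_const v z))
    have l2 : HasFDerivAt (fun y => lamL y v + fderiv ℝ F y v) _ z :=
      (lamL.hasFDerivAt.clm_apply (hasFDerivAt_const v z)).add
        (dF'.hasFDerivAt.clm_apply (hasFDerivAt_const v z))
    have : (fun y => lamL (g y) (fderiv ℝ g y v)) = (fun y => lamL y v + fderiv ℝ F y v) := by
      ext y; simp only [lamL_apply]; exact F3 y v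
    rw [this] at l1
    have e := congrArg (fun L => L w) (l1.unique l2)
    simp [lamL_apply] at e
    linarith
  have k1 := key (1, 0) (0, 1)
  have k2 := key (0, 1) (1, 0)
  rw [sg.eq (0, 1) (1, 0), sF.eq (0, 1) (1, 0)] at k1
  have e1 : fderiv ℝ (fun q => (g q).1) z = (ContinuousLinearMap.fst ℝ ℝ ℝ).comp (fderiv ℝ g z) :=
    dg.hasFDerivAt.fst.fderiv
  have e2 : fderiv ℝ (fun q => (g q).2) z = (ContinuousLinearMap.snd ℝ ℝ ℝ).comp (fderiv ℝ g z) :=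
    dg.hasFDerivAt.snd.fderiv
  simp only [jacDet, pdx, pdy, e1, e2]
  simp only [lam] at k1 k2
  simp only [ContinuousLinearMap.comp_apply, ContinuousLinearMap.coe_fst',
    ContinuousLinearMap.coe_snd']
  linarith

lemma Good.isSympO {g : Equiv.Perm (ℝ × ℝ)} {c : ℝ} (hg : Good g c) : IsSympO g := by
  refine ⟨⟨hg.sm, fun p hp => (hg.dsk p).2 hp, fun p _ => hg.jac p, g.symm, hg.smi,
    fun p hp => ?_, by simp, by simp⟩, hg.zero⟩
  rw [← hg.dsk]; simpa using hp

lemma Good.sigma {g : Equiv.Perm (ℝ × ℝ)} {c : ℝ} (hg : Good g c) (h1 : g (1, 0) = (1, 0)) :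
    ∃ m : ℤ, 2 * sigmaQ g = c + m * (2 * π) := by
  obtain ⟨F, F1, F2, F3, F4⟩ := hg.ex
  have hs : 2 * sigmaQ g = F (1, 0) := by
    have hd : ∀ t : ℝ, HasDerivAt (fun t : ℝ => F (t, 0)) (fderiv ℝ F (t, 0) (1, 0)) t := by
      intro t
      have dF : HasFDerivAt F _ ((t, 0) : ℝ × ℝ) := (F1.differentiable (by simp) _).hasFDerivAt
      exact dF.comp_hasDerivAt t ((hasDerivAt_id t).prodMk (hasDerivAt_const t (0:ℝ)))
    have hc : Continuous fun t : ℝ => fderiv ℝ F (t, 0) (1, 0) := by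
      have : Continuous (fderiv ℝ F) := F1.continuous_fderiv (by simp)
      exact (this.comp (by fun_prop : Continuous fun t : ℝ => ((t, 0) : ℝ × ℝ))).clm_apply
        continuous_const
    have hi := intervalIntegral.integral_eq_sub_of_hasDerivAt (fun t _ => hd t)
      (hc.intervalIntegrable 0 1)
    have he : ∀ t : ℝ, (g (t, 0)).1 * pdx (fun q => (g q).2) (t, 0) -
      (g (t, 0)).2 * pdx (fun q => (g q).1) (t, 0) = fderiv ℝ F (t, 0) (1, 0) := by
      intro t
      have dg : DifferentiableAt ℝ g (t, 0) := hg.sm.differentiable (by simp) _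
      have e1 : fderiv ℝ (fun q => (g q).1) (t, 0) =
        (ContinuousLinearMap.fst ℝ ℝ ℝ).comp (fderiv ℝ g (t, 0)) := dg.hasFDerivAt.fst.fderiv
      have e2 : fderiv ℝ (fun q => (g q).2) (t, 0) =
        (ContinuousLinearMap.snd ℝ ℝ ℝ).comp (fderiv ℝ g (t, 0)) := dg.hasFDerivAt.snd.fderiv
      have := F3 (t, 0) (1, 0)
      simp only [lam] at this
      simp only [pdx, e1, e2, ContinuousLinearMap.comp_apply, ContinuousLinearMap.coe_fst',
        ContinuousLinearMap.coe_snd']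
      linarith
    simp only [sigmaQ, he]
    rw [hi, F2]; ring
  have h4 := F4 (1, 0) (by simp [bdry])
  rw [h1] at h4
  have h5 : cos (F (1, 0) - c) = 1 := by
    have := congrArg Prod.fst h4
    simpa [rot] using this.symm
  obtain ⟨m, hm⟩ := (cos_eq_one_iff _).1 h5
  exact ⟨m, by rw [hs, hm]; ring⟩

/-- rotation as a permutation -/
def rotE (a : ℝ) : Equiv.Perm (ℝ × ℝ) where
  toFun := rot a
  invFun := rot (-a)
  left_inv p := by rw [rot_rot]; simp [rot_zero]
  right_inv p := by rw [rot_rot]; simp [rot_zero]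

lemma rotE_apply (a : ℝ) (p : ℝ × ℝ) : rotE a p = rot a p := rfl

lemma rot_contDiff (a : ℝ) : ContDiff ℝ (⊤ : ℕ∞) (rot a) := by
  unfold rot; fun_prop

lemma good_rot (a : ℝ) : Good (rotE a) (-a) := by
  refine ⟨rot_contDiff a, rot_contDiff (-a), fun p => ?_, by simp [rotE, rot], fun _ => 0, 
    contDiff_const, rfl, ?_, ?_⟩
  · simp only [disk, mem_ofPred_eq, rotE_apply, rot_sq]
  · intro z v
    have : HasFDerivAt (rot a) (((cos a) • ContinuousLinearMap.fst ℝ ℝ ℝ - 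
      (sin a) • ContinuousLinearMap.snd ℝ ℝ ℝ).prod ((sin a) • ContinuousLinearMap.fst ℝ ℝ ℝ +
      (cos a) • ContinuousLinearMap.snd ℝ ℝ ℝ)) z :=
      (((hasFDerivAt_fst).const_mul (cos a)).sub ((hasFDerivAt_snd).const_mul (sin a))).prodMk
      (((hasFDerivAt_fst).const_mul (sin a)).add ((hasFDerivAt_snd).const_mul (cos a)))
    change lam (rot a z) (fderiv ℝ (rot a) z v) = _
    rw [this.fderiv]
    simp [lam, rot]
    linear_combination (z.1 * v.2 - z.2 * v.1) * sin_sq_add_cos_sq a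
  · intro p hp
    simp [rotE_apply]


lemma exists_perm {g : ℝ × ℝ → ℝ × ℝ} (hg : ContDiff ℝ (⊤ : ℕ∞) g)
    (hb : ∀ z, ‖fderiv ℝ g z - ContinuousLinearMap.id ℝ (ℝ × ℝ)‖ ≤ 1 / 2) :
    ∃ e : Equiv.Perm (ℝ × ℝ), (e : ℝ × ℝ → ℝ × ℝ) = g ∧ ContDiff ℝ (⊤ : ℕ∞) e.symm := by
  have hd : Differentiable ℝ g := hg.differentiable (by simp)
  have ha : ApproximatesLinearOn g
      ((ContinuousLinearEquiv.refl ℝ (ℝ × ℝ) : (ℝ × ℝ) ≃L[ℝ] (ℝ × ℝ)) : (ℝ × ℝ) →L[ℝ] (ℝ × ℝ))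
      univ (1 / 2 : NNReal) := by
    rw [ApproximatesLinearOn.approximatesLinearOn_iff_lipschitzOnWith]
    refine Convex.lipschitzOnWith_of_nnnorm_hasFDerivWithin_le
      (f' := fun z => fderiv ℝ g z - ContinuousLinearMap.id ℝ (ℝ × ℝ)) ?_ ?_ convex_univ
    · intro z _
      exact ((hd z).hasFDerivAt.sub (ContinuousLinearMap.hasFDerivAt _)).hasFDerivWithinAt
    · intro z _
      rw [← NNReal.coe_le_coe]
      simpa using hb z
  have hn : (1 / 2 : NNReal) < ‖((ContinuousLinearEquiv.refl ℝ (ℝ × ℝ)).symm :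
      (ℝ × ℝ) →L[ℝ] (ℝ × ℝ))‖₊⁻¹ := by
    rw [← NNReal.coe_lt_coe]
    have : ‖((ContinuousLinearEquiv.refl ℝ (ℝ × ℝ)).symm :
      (ℝ × ℝ) →L[ℝ] (ℝ × ℝ))‖ = 1 := by
      simp
    simp only [NNReal.coe_inv, coe_nnnorm, this]
    norm_num
  let H : (ℝ × ℝ) ≃ₜ (ℝ × ℝ) := ha.toHomeomorph g (Or.inr hn)
  have hH : (H : ℝ × ℝ → ℝ × ℝ) = g := rfl
  refine ⟨H.toEquiv, rfl, ?_⟩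
  have hu : ∀ z, ∃ L : (ℝ × ℝ) ≃L[ℝ] (ℝ × ℝ), (L : (ℝ × ℝ) →L[ℝ] (ℝ × ℝ)) = fderiv ℝ g z := by
    intro z
    let T : (ℝ × ℝ) →L[ℝ] (ℝ × ℝ) := ContinuousLinearMap.id ℝ (ℝ × ℝ) - fderiv ℝ g z
    have hT : ‖T‖ < 1 := by
      have := hb z
      rw [norm_sub_rev] at this
      exact lt_of_le_of_lt this (by norm_num)
    refine ⟨ContinuousLinearEquiv.unitsEquiv ℝ (ℝ × ℝ) (Units.oneSub T hT), ?_⟩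
    ext1 <;> ext <;> simp [T]
  choose L hL using hu
  exact H.contDiff_symm (f₀' := L) (fun z => by rw [hL]; exact (hd z).hasFDerivAt) hg

/-- r squared -/
def rsq (z : ℝ × ℝ) : ℝ := z.1 ^ 2 + z.2 ^ 2
/-- angular derivative -/
def om (b : ℝ × ℝ → ℝ) (z : ℝ × ℝ) : ℝ := fderiv ℝ b z (-z.2, z.1)
/-- Euler derivative -/
def eu (b : ℝ × ℝ → ℝ) (z : ℝ × ℝ) : ℝ := fderiv ℝ b z z
def bb (β : ℝ × ℝ → ℝ) (z : ℝ × ℝ) : ℝ := (rsq z - 1) * β z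
def rho (β : ℝ × ℝ → ℝ) (z : ℝ × ℝ) : ℝ × ℝ := √(1 + om (bb β) z) • z
def del (β : ℝ × ℝ → ℝ) (z : ℝ × ℝ) : ℝ := bb β z + 1 / 2 * eu (bb β) z
def ff (β : ℝ × ℝ → ℝ) (z : ℝ × ℝ) : ℝ × ℝ := rot (del β z) z

lemma rsq_contDiff : ContDiff ℝ (⊤ : ℕ∞) rsq := by unfold rsq; fun_prop

lemma hasFDerivAt_rsq (z : ℝ × ℝ) : HasFDerivAt rsq ((2 * z.1) • ContinuousLinearMap.fst ℝ ℝ ℝ +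
      (2 * z.2) • ContinuousLinearMap.snd ℝ ℝ ℝ) z := by
  have : HasFDerivAt rsq _ z := ((hasFDerivAt_fst (𝕜 := ℝ) (p := z)).pow 2).add
      ((hasFDerivAt_snd (𝕜 := ℝ) (p := z)).pow 2)
  exact this.congr_fderiv (by simp)

lemma bb_contDiff {β : ℝ × ℝ → ℝ} (h : ContDiff ℝ (⊤ : ℕ∞) β) : ContDiff ℝ (⊤ : ℕ∞) (bb β) := by
  unfold bb; exact (rsq_contDiff.sub contDiff_const).mul h

lemma fderiv_bb {β : ℝ × ℝ → ℝ} (h : ContDiff ℝ (⊤ : ℕ∞) β) (z v : ℝ × ℝ) :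
    fderiv ℝ (bb β) z v = (rsq z - 1) * fderiv ℝ β z v +
      2 * (z.1 * v.1 + z.2 * v.2) * β z := by
  have h1 := hasFDerivAt_rsq z
  have h2 : HasFDerivAt β _ z := (h.differentiable (by simp) z).hasFDerivAt
  have h3 : HasFDerivAt (bb β) _ z := (h1.sub_const 1).mul h2
  rw [h3.fderiv]
  simp; ring

lemma om_contDiff {b : ℝ × ℝ → ℝ} (h : ContDiff ℝ (⊤ : ℕ∞) b) : ContDiff ℝ (⊤ : ℕ∞) (om b) := by
  unfold om
  exact (h.fderiv_right (m := (⊤ : ℕ∞)) (by simp)).clm_apply (by fun_prop)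

lemma eu_contDiff {b : ℝ × ℝ → ℝ} (h : ContDiff ℝ (⊤ : ℕ∞) b) : ContDiff ℝ (⊤ : ℕ∞) (eu b) := by
  unfold eu
  exact (h.fderiv_right (m := (⊤ : ℕ∞)) (by simp)).clm_apply (by fun_prop)

lemma del_contDiff {β : ℝ × ℝ → ℝ} (h : ContDiff ℝ (⊤ : ℕ∞) β) : ContDiff ℝ (⊤ : ℕ∞) (del β) := by
  unfold del
  exact (bb_contDiff h).add (contDiff_const.mul (eu_contDiff (bb_contDiff h)))

lemma ff_contDiff {β : ℝ × ℝ → ℝ} (h : ContDiff ℝ (⊤ : ℕ∞) β) : ContDiff ℝ (⊤ : ℕ∞) (ff β) := by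
  have := del_contDiff h
  unfold ff rot
  fun_prop

lemma rho_contDiff {β : ℝ × ℝ → ℝ} (h : ContDiff ℝ (⊤ : ℕ∞) β) (hp : ∀ z, 0 < 1 + om (bb β) z) :
    ContDiff ℝ (⊤ : ℕ∞) (rho β) := by
  unfold rho
  exact ((contDiff_const.add (om_contDiff (bb_contDiff h))).sqrt (fun z => (hp z).ne')).smul
    contDiff_id

lemma lam_rho {β : ℝ × ℝ → ℝ} (h : ContDiff ℝ (⊤ : ℕ∞) β) (hp : ∀ z, 0 < 1 + om (bb β) z)
    (z v : ℝ × ℝ) : lam (rho β z) (fderiv ℝ (rho β) z v) = (1 + om (bb β) z) * lam z v := by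
  have h1 : HasFDerivAt (fun z => √(1 + om (bb β) z)) _ z :=
    (((contDiff_const.add (om_contDiff (bb_contDiff h))).sqrt
      (fun z => (hp z).ne')).differentiable (by simp) z).hasFDerivAt
  have h2 : HasFDerivAt (rho β) _ z := h1.smul (hasFDerivAt_id z)
  rw [h2.fderiv]
  have hs := Real.sq_sqrt (hp z).le
  simp [lam, rho]
  linear_combination (z.1 * v.2 - z.2 * v.1) * hs

lemma lam_ff {β : ℝ × ℝ → ℝ} (h : ContDiff ℝ (⊤ : ℕ∞) β)
    (z v : ℝ × ℝ) : lam (ff β z) (fderiv ℝ (ff β) z v) = lam z v + rsq z * fderiv ℝ (del β) z v := by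
  have h1 : HasFDerivAt (del β) _ z := ((del_contDiff h).differentiable (by simp) z).hasFDerivAt
  have h2 : HasFDerivAt (ff β) _ z :=
    ((h1.cos.mul hasFDerivAt_fst).sub (h1.sin.mul hasFDerivAt_snd)).prodMk
    ((h1.sin.mul hasFDerivAt_fst).add (h1.cos.mul hasFDerivAt_snd))
  rw [h2.fderiv]
  simp [lam, ff, rot, rsq]
  linear_combination (z.1 * v.2 - z.2 * v.1 + (z.1 ^ 2 + z.2 ^ 2) * fderiv ℝ (del β) z v) *
    sin_sq_add_cos_sq (del β z)

lemma fderiv_decomp (L : (ℝ × ℝ) →L[ℝ] ℝ) (z v : ℝ × ℝ) :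
    (z.1 * v.1 + z.2 * v.2) * L z + lam z v * L (-z.2, z.1) = rsq z * L v := by
  have hL : ∀ w : ℝ × ℝ, L w = w.1 * L (1, 0) + w.2 * L (0, 1) := by
    intro w
    have : w = w.1 • (1, 0) + w.2 • (0, 1) := by ext <;> simp
    conv_lhs => rw [this]
    rw [map_add, map_smul, map_smul]; simp
  rw [hL z, hL v, hL (-z.2, z.1)]
  simp only [lam, rsq]; ring

def GG (β : ℝ × ℝ → ℝ) (z : ℝ × ℝ) : ℝ := rsq z * (del β z - bb β z)

lemma fderiv_GG {β : ℝ × ℝ → ℝ} (h : ContDiff ℝ (⊤ : ℕ∞) β) (z v : ℝ × ℝ) :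
    fderiv ℝ (GG β) z v = rsq z * fderiv ℝ (del β) z v - om (bb β) z * lam z v := by
  have h1 := hasFDerivAt_rsq z
  have h2 : HasFDerivAt (del β) _ z := ((del_contDiff h).differentiable (by simp) z).hasFDerivAt
  have h3 : HasFDerivAt (bb β) _ z := ((bb_contDiff h).differentiable (by simp) z).hasFDerivAt
  have h4 : HasFDerivAt (GG β) _ z := h1.mul (h2.sub h3)
  rw [h4.fderiv]
  have := fderiv_decomp (fderiv ℝ (bb β) z) z v
  simp [om, del, eu]
  linear_combination this

lemma om_bb {β : ℝ × ℝ → ℝ} (h : ContDiff ℝ (⊤ : ℕ∞) β) (z : ℝ × ℝ) :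
    om (bb β) z = (rsq z - 1) * om β z := by
  rw [om, fderiv_bb h, om]; simp; left; ring

lemma good_of_beta {β : ℝ × ℝ → ℝ} (h : ContDiff ℝ (⊤ : ℕ∞) β) (hp : ∀ z, 0 < 1 + om (bb β) z)
    (hq : ∀ z, 0 < 1 + rsq z * om β z)
    (hr : ∀ z, ‖fderiv ℝ (rho β) z - ContinuousLinearMap.id ℝ (ℝ × ℝ)‖ ≤ 1 / 2)
    (hf : ∀ z, ‖fderiv ℝ (ff β) z - ContinuousLinearMap.id ℝ (ℝ × ℝ)‖ ≤ 1 / 2) :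
    ∃ g : Equiv.Perm (ℝ × ℝ), Good g 0 ∧ ∀ p ∈ bdry, g p = rot (β p) p := by
  have sr := rho_contDiff h hp
  have sf := ff_contDiff h
  obtain ⟨er, her, hri⟩ := exists_perm sr hr
  obtain ⟨ef, hef, hfi⟩ := exists_perm sf hf
  have bfix : ∀ p ∈ bdry, er.symm p = p := by
    intro p hp
    rw [Equiv.symm_apply_eq, her]
    have : rsq p = 1 := hp
    simp [rho, om_bb h, this]
  have hbd : ∀ p ∈ bdry, ef p = rot (β p) p ∧ GG β p = β p := by
    intro p hp
    have h1 : rsq p = 1 := hp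
    have h2 : bb β p = 0 := by simp [bb, h1]
    have h3 : eu (bb β) p = 2 * β p := by
      rw [eu, fderiv_bb h, h1]
      have : p.1 * p.1 + p.2 * p.2 = 1 := by rw [← h1, rsq]; ring
      rw [this]; ring
    have h4 : del β p = β p := by rw [del, h2, h3]; ring
    exact ⟨by rw [hef, ff, h4], by rw [GG, h1, h2, h4]; ring⟩
  have hz : er.symm (0, 0) = (0, 0) := by
    rw [Equiv.symm_apply_eq, her]; simp [rho]
  have hG : ContDiff ℝ (⊤ : ℕ∞) (GG β) :=
    rsq_contDiff.mul ((del_contDiff h).sub (bb_contDiff h))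
  refine ⟨ef * er⁻¹, ⟨?_, ?_, ?_, ?_, fun z => GG β (er.symm z), hG.comp hri, ?_, ?_, ?_⟩, ?_⟩
  · change ContDiff ℝ (⊤ : ℕ∞) (ef ∘ er.symm)
    rw [hef]; exact sf.comp hri
  · change ContDiff ℝ (⊤ : ℕ∞) (er ∘ ef.symm)
    rw [her]; exact sr.comp hfi
  · intro p
    have hp' : p = rho β (er.symm p) := by rw [← her]; simp
    change ef (er.symm p) ∈ disk ↔ _
    generalize er.symm p = q at *
    rw [hp', hef]
    have e1 : rsq (ff β q) = rsq q := rot_sq _ _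
    have e2 : rsq (rho β q) - 1 = (rsq q - 1) * (1 + rsq q * om β q) := by
      have hs := Real.sq_sqrt (hp q).le
      have : rsq (rho β q) = (1 + om (bb β) q) * rsq q := by
        simp only [rho, rsq, Prod.smul_fst, Prod.smul_snd, smul_eq_mul]
        linear_combination (q.1 ^ 2 + q.2 ^ 2) * hs
      rw [this, om_bb h]; ring
    change rsq (ff β q) ≤ 1 ↔ rsq (rho β q) ≤ 1
    rw [e1]
    have := hq q
    constructor
    · intro h5; nlinarith
    · intro h5; by_contra h6; push Not at h6; nlinarith
  · change ef (er.symm (0, 0)) = (0, 0)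
    rw [hz, hef]; simp [ff, rot]
  · simp only [hz]; simp [GG, rsq]
  · intro w v
    have d1 : DifferentiableAt ℝ er.symm w := hri.differentiable (by simp) w
    have d2 : DifferentiableAt ℝ (ff β) (er.symm w) := sf.differentiable (by simp) _
    have d3 : DifferentiableAt ℝ (rho β) (er.symm w) := sr.differentiable (by simp) _
    have d4 : DifferentiableAt ℝ (GG β) (er.symm w) := hG.differentiable (by simp) _
    have e1 : fderiv ℝ (ef * er⁻¹ : Equiv.Perm (ℝ × ℝ)) w =
        (fderiv ℝ (ff β) (er.symm w)).comp (fderiv ℝ er.symm w) := by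
      rw [← fderiv_comp w d2 d1, ← hef]; rfl
    have e2 : fderiv ℝ (fun z => GG β (er.symm z)) w =
        (fderiv ℝ (GG β) (er.symm w)).comp (fderiv ℝ er.symm w) := fderiv_comp w d4 d1
    have e3 : (fderiv ℝ (rho β) (er.symm w)).comp (fderiv ℝ er.symm w) =
        ContinuousLinearMap.id ℝ _ := by
      rw [← fderiv_comp w d3 d1, ← her]; simp
    have e4 : fderiv ℝ (rho β) (er.symm w) (fderiv ℝ er.symm w v) = v := by
      have := congrArg (fun L => L v) e3
      simpa using this
    have e5 := lam_rho h hp (er.symm w) (fderiv ℝ er.symm w v)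
    rw [e4, ← her, Equiv.apply_symm_apply] at e5
    have e6 := lam_ff h (er.symm w) (fderiv ℝ er.symm w v)
    rw [e1, e2]
    change lam (ef (er.symm w)) _ = _
    rw [hef]
    simp only [ContinuousLinearMap.comp_apply]
    rw [e6, fderiv_GG h, e5]; ring
  · intro p hp
    change ef (er.symm p) = rot (GG β (er.symm p) - 0) p
    rw [bfix p hp, (hbd p hp).1, (hbd p hp).2, sub_zero]
  · intro p hp
    change ef (er.symm p) = _
    rw [bfix p hp, (hbd p hp).1]


lemma joint_fderiv {V : Type*} [NormedAddCommGroup V] [NormedSpace ℝ V] {b : ℝ → ℝ × ℝ → V}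
    {x : ℝ × (ℝ × ℝ)} (h : ContDiffAt ℝ (⊤ : ℕ∞) (fun x : ℝ × (ℝ × ℝ) => b x.1 x.2) x) :
    ContDiffAt ℝ (⊤ : ℕ∞) (fun x : ℝ × (ℝ × ℝ) => fderiv ℝ (b x.1) x.2) x := by
  refine ContDiffAt.fderiv (n := (⊤ : ℕ∞)) (f := fun x : ℝ × (ℝ × ℝ) => b x.1)
    (g := fun x => x.2) ?_ contDiffAt_snd (by simp)
  have : ContDiffAt ℝ (⊤ : ℕ∞) (fun y : (ℝ × (ℝ × ℝ)) × (ℝ × ℝ) => ((y.1.1, y.2) : ℝ × (ℝ × ℝ)))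
    (x, x.2) := by fun_prop
  exact ContDiffAt.comp (x, x.2) (g := fun x : ℝ × (ℝ × ℝ) => b x.1 x.2) h this

lemma eventually_good {bt : ℝ → ℝ × ℝ → ℝ}
    (hb : ContDiff ℝ (⊤ : ℕ∞) (fun x : ℝ × (ℝ × ℝ) => bt x.1 x.2))
    (h0 : bt 0 = fun _ => 0) (hs : ∀ ε z, z ∉ Metric.closedBall (0 : ℝ × ℝ) 3 → bt ε z = 0) :
    ∀ᶠ ε in 𝓝 (0 : ℝ), ∃ g : Equiv.Perm (ℝ × ℝ), Good g 0 ∧ ∀ p ∈ bdry, g p = rot (bt ε p) p := by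
  have hbε : ∀ ε, ContDiff ℝ (⊤ : ℕ∞) (bt ε) := fun ε =>
    hb.comp (contDiff_const.prodMk contDiff_id)
  have hb2 : ContDiff ℝ (⊤ : ℕ∞) (fun x : ℝ × (ℝ × ℝ) => bb (bt x.1) x.2) := by
    unfold bb
    exact ((rsq_contDiff.comp contDiff_snd).sub contDiff_const).mul hb
  have hom : ∀ {b : ℝ → ℝ × ℝ → ℝ}, ContDiff ℝ (⊤ : ℕ∞) (fun x : ℝ × (ℝ × ℝ) => b x.1 x.2) →
      ContDiff ℝ (⊤ : ℕ∞) (fun x : ℝ × (ℝ × ℝ) => om (b x.1) x.2) := by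
    intro b h
    unfold om
    exact (contDiff_iff_contDiffAt.2 fun x => joint_fderiv (b := b) h.contDiffAt).clm_apply (by fun_prop)
  have heu : ContDiff ℝ (⊤ : ℕ∞) (fun x : ℝ × (ℝ × ℝ) => eu (bb (bt x.1)) x.2) := by
    unfold eu
    exact (contDiff_iff_contDiffAt.2 fun x => joint_fderiv (b := fun ε => bb (bt ε)) hb2.contDiffAt).clm_apply (by fun_prop)
  have hdel : ContDiff ℝ (⊤ : ℕ∞) (fun x : ℝ × (ℝ × ℝ) => del (bt x.1) x.2) := by
    unfold del
    exact hb2.add (contDiff_const.mul heu)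
  have hff : ContDiff ℝ (⊤ : ℕ∞) (fun x : ℝ × (ℝ × ℝ) => ff (bt x.1) x.2) := by
    unfold ff rot
    fun_prop
  have z1 : bb (bt 0) = fun _ => 0 := by ext z; simp [bb, h0]
  have z2 : om (bb (bt 0)) = fun _ => 0 := by ext z; simp [om, z1]
  have z3 : om (bt 0) = fun _ => 0 := by ext z; simp [om, h0]
  have z4 : rho (bt 0) = id := by ext z <;> simp [rho, z2]
  have z5 : ff (bt 0) = id := by ext z <;> simp [ff, rot, del, z1, eu]
  have hrho : ∀ z, ContDiffAt ℝ (⊤ : ℕ∞) (fun x : ℝ × (ℝ × ℝ) => rho (bt x.1) x.2) (0, z) := by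
    intro z
    unfold rho
    refine ((contDiffAt_const.add (hom (b := fun ε => bb (bt ε)) hb2).contDiffAt).sqrt ?_).smul contDiffAt_snd
    simp [z2]
  have main := (isCompact_closedBall (0 : ℝ × ℝ) 3).eventually_forall_of_forall_eventually
    (x₀ := (0 : ℝ)) (P := fun ε z => 0 < 1 + om (bb (bt ε)) z ∧ 0 < 1 + rsq z * om (bt ε) z ∧
      ‖fderiv ℝ (rho (bt ε)) z - ContinuousLinearMap.id ℝ (ℝ × ℝ)‖ < 1 / 2 ∧
      ‖fderiv ℝ (ff (bt ε)) z - ContinuousLinearMap.id ℝ (ℝ × ℝ)‖ < 1 / 2) (by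
    intro z _
    refine Eventually.and ?_ (Eventually.and ?_ (Eventually.and ?_ ?_))
    · refine continuousAt_const.eventually_lt
        (continuousAt_const.add (hom (b := fun ε => bb (bt ε)) hb2).continuous.continuousAt) ?_
      simp [z2]
    · refine continuousAt_const.eventually_lt (continuousAt_const.add
        ((rsq_contDiff.continuous.comp continuous_snd).mul (hom (b := bt) hb).continuous).continuousAt) ?_
      simp [z3]
    · refine ((joint_fderiv (b := fun ε => rho (bt ε)) (hrho z)).continuousAt.sub continuousAt_const).norm.eventually_lt
        continuousAt_const ?_
      simp [z4]
    · refine ((joint_fderiv (b := fun ε => ff (bt ε)) (x := (0, z)) hff.contDiffAt).continuousAt.sub continuousAt_const).norm.eventually_lt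
        continuousAt_const ?_
      simp [z5])
  filter_upwards [main] with ε hε
  have out : ∀ z ∉ Metric.closedBall (0 : ℝ × ℝ) 3, 0 < 1 + om (bb (bt ε)) z ∧
      0 < 1 + rsq z * om (bt ε) z ∧
      ‖fderiv ℝ (rho (bt ε)) z - ContinuousLinearMap.id ℝ (ℝ × ℝ)‖ < 1 / 2 ∧
      ‖fderiv ℝ (ff (bt ε)) z - ContinuousLinearMap.id ℝ (ℝ × ℝ)‖ < 1 / 2 := by
    intro z hz
    have ev : ∀ᶠ w in 𝓝 z, w ∉ Metric.closedBall (0 : ℝ × ℝ) 3 :=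
      Metric.isClosed_closedBall.isOpen_compl.mem_nhds hz
    have e1 : ∀ w ∉ Metric.closedBall (0 : ℝ × ℝ) 3, bt ε =ᶠ[𝓝 w] fun _ => 0 := by
      intro w hw
      filter_upwards [Metric.isClosed_closedBall.isOpen_compl.mem_nhds hw] with u hu
      exact hs ε u hu
    have e2 : ∀ w ∉ Metric.closedBall (0 : ℝ × ℝ) 3, bb (bt ε) =ᶠ[𝓝 w] fun _ => 0 := by
      intro w hw
      filter_upwards [e1 w hw] with u hu
      simp [bb, hu]
    have o1 : ∀ w ∉ Metric.closedBall (0 : ℝ × ℝ) 3, om (bt ε) w = 0 := by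
      intro w hw; simp [om, (e1 w hw).fderiv_eq]
    have o2 : ∀ w ∉ Metric.closedBall (0 : ℝ × ℝ) 3, om (bb (bt ε)) w = 0 := by
      intro w hw; simp [om, (e2 w hw).fderiv_eq]
    have o3 : rho (bt ε) =ᶠ[𝓝 z] id := by
      filter_upwards [ev] with w hw
      simp [rho, o2 w hw]
    have o4 : ff (bt ε) =ᶠ[𝓝 z] id := by
      filter_upwards [ev] with w hw
      simp [ff, rot, del, eu, (e2 w hw).fderiv_eq, (e2 w hw).self_of_nhds]
    rw [o1 z hz, o2 z hz, o3.fderiv_eq, o4.fderiv_eq]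
    simp
  have all : ∀ z, 0 < 1 + om (bb (bt ε)) z ∧ 0 < 1 + rsq z * om (bt ε) z ∧
      ‖fderiv ℝ (rho (bt ε)) z - ContinuousLinearMap.id ℝ (ℝ × ℝ)‖ < 1 / 2 ∧
      ‖fderiv ℝ (ff (bt ε)) z - ContinuousLinearMap.id ℝ (ℝ × ℝ)‖ < 1 / 2 := fun z => by
    by_cases hz : z ∈ Metric.closedBall (0 : ℝ × ℝ) 3
    · exact hε z hz
    · exact out z hz
  exact good_of_beta (hbε ε) (fun z => (all z).1) (fun z => (all z).2.1)
    (fun z => (all z).2.2.1.le) (fun z => (all z).2.2.2.le)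

/-- `g` acts on the circle of directions as the linear map `A` -/
def Acts (g : Equiv.Perm (ℝ × ℝ)) (A : (ℝ × ℝ) →ₗ[ℝ] (ℝ × ℝ)) : Prop :=
  ∀ p ∈ bdry, ∃ t : ℝ, 0 < t ∧ A p = t • g p

def mat (a b c d : ℝ) : (ℝ × ℝ) →ₗ[ℝ] (ℝ × ℝ) :=
  (a • LinearMap.fst ℝ ℝ ℝ + b • LinearMap.snd ℝ ℝ ℝ).prod
    (c • LinearMap.fst ℝ ℝ ℝ + d • LinearMap.snd ℝ ℝ ℝ)

lemma mat_apply (a b c d : ℝ) (p : ℝ × ℝ) :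
    mat a b c d p = (a * p.1 + b * p.2, c * p.1 + d * p.2) := by
  simp [mat]

lemma Acts.mul {g h : Equiv.Perm (ℝ × ℝ)} {A B : (ℝ × ℝ) →ₗ[ℝ] (ℝ × ℝ)} {c : ℝ}
    (hg : Acts g A) (hh : Acts h B) (hc : Good h c) : Acts (g * h) (A ∘ₗ B) := by
  intro p hp
  obtain ⟨t, ht, e⟩ := hh p hp
  obtain ⟨s, hs, e'⟩ := hg (h p) (hc.bd hp)
  exact ⟨t * s, mul_pos ht hs, by simp [e, e', mul_smul]⟩

lemma Acts.inv {g : Equiv.Perm (ℝ × ℝ)} {A B : (ℝ × ℝ) →ₗ[ℝ] (ℝ × ℝ)} {c r : ℝ}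
    (hg : Acts g A) (hc : Good g c) (hr : 0 < r) (hB : ∀ p, B (A p) = r • p) : Acts g⁻¹ B := by
  intro p hp
  obtain ⟨t, ht, e⟩ := hg (g.symm p) (hc.inv_bd hp)
  refine ⟨r / t, div_pos hr ht, ?_⟩
  have h1 := hB (g.symm p)
  rw [e, Equiv.apply_symm_apply, map_smul] at h1
  change B p = (r / t) • g.symm p
  rw [div_eq_inv_mul, mul_smul, ← h1, smul_smul, inv_mul_cancel₀ ht.ne', one_smul]

lemma acts_rot (a : ℝ) {r : ℝ} (hr : 0 < r) :
    Acts (rotE a) (mat (r * cos a) (-(r * sin a)) (r * sin a) (r * cos a)) := by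
  intro p _
  refine ⟨r, hr, ?_⟩
  rw [mat_apply, rotE_apply, rot]
  ext <;> simp <;> ring

/-- the cutoff -/
def bump : ContDiffBump (0 : ℝ × ℝ) := ⟨2, 3, by norm_num, by norm_num⟩

def btt (ε : ℝ) (z : ℝ × ℝ) : ℝ :=
  bump z * arctan (ε ^ 2 * (z.1 * z.2) / (1 + ε ^ 2 * z.2 ^ 2))

lemma eventually_diag : ∀ᶠ ε in 𝓝 (0 : ℝ), ∃ g : Equiv.Perm (ℝ × ℝ), Good g 0 ∧
    Acts g (mat 1 0 0 (1 + ε ^ 2)) := by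
  have h := eventually_good (bt := btt) (by
      unfold btt
      refine (bump.contDiff.comp contDiff_snd).mul (ContDiff.arctan ?_)
      refine ContDiff.div (by fun_prop) (by fun_prop) (fun x => by positivity))
    (by ext z; simp [btt]) (by
      intro ε z hz
      have : bump z = 0 := by
        apply bump.zero_of_le_dist
        simp only [Metric.mem_closedBall, not_le] at hz
        exact hz.le
      simp [btt, this])
  filter_upwards [h] with ε hε
  obtain ⟨g, hg, hgb⟩ := hε
  refine ⟨g, hg, ?_⟩
  intro p hp
  rw [hgb p hp]
  have hp1 : p.1 ^ 2 + p.2 ^ 2 = 1 := hp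
  have hb1 : bump p = 1 := by
    apply bump.one_of_mem_closedBall
    simp only [Metric.mem_closedBall, dist_zero_right, Prod.norm_def, bump, Real.norm_eq_abs]
    refine max_le ?_ ?_ <;> apply abs_le_of_sq_le_sq <;> nlinarith [sq_nonneg p.1, sq_nonneg p.2]
  set T := ε ^ 2 * (p.1 * p.2) / (1 + ε ^ 2 * p.2 ^ 2) with hT
  have hd : 0 < 1 + ε ^ 2 * p.2 ^ 2 := by positivity
  have hTd : T * (1 + ε ^ 2 * p.2 ^ 2) = ε ^ 2 * (p.1 * p.2) := by
    rw [hT]; field_simp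
  have hS : 0 < √(1 + T ^ 2) := by positivity
  refine ⟨(1 + ε ^ 2 * p.2 ^ 2) * √(1 + T ^ 2), mul_pos hd hS, ?_⟩
  rw [btt, hb1, one_mul, ← hT, mat_apply, rot, cos_arctan, sin_arctan]
  ext
  · simp only [Prod.smul_fst, smul_eq_mul]
    field_simp
    linear_combination p.2 * hTd
  · simp only [Prod.smul_snd, smul_eq_mul]
    field_simp
    linear_combination -p.1 * hTd - ε ^ 2 * p.2 * hp1

lemma good_one : Good 1 0 := by
  have h := (good_rot 0).mul (good_rot 0).inv
  simpa using h

lemma Good.pow {g : Equiv.Perm (ℝ × ℝ)} (h : Good g 0) (n : ℕ) : Good (g ^ n) 0 := by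
  induction n with
  | zero => simpa using good_one
  | succ n ih => rw [pow_succ]; simpa using ih.mul h

lemma exists_diag {μ : ℝ} (hμ : 1 < μ) : ∃ g : Equiv.Perm (ℝ × ℝ), Good g 0 ∧
    Acts g (mat 1 0 0 μ) := by
  have ht : Tendsto (fun n : ℕ => √(μ ^ (1 / (n : ℝ)) - 1)) atTop (𝓝 0) := by
    have h1 : Tendsto (fun n : ℕ => 1 / (n : ℝ)) atTop (𝓝 0) := tendsto_one_div_atTop_nhds_zero_nat
    have h2 : Continuous fun x : ℝ => √(μ ^ x - 1) := by
      have : Continuous fun x : ℝ => μ ^ x := Real.continuous_const_rpow (by positivity)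
      fun_prop
    have := (h2.tendsto 0).comp h1
    simpa [Function.comp_def] using this
  obtain ⟨n, ⟨g, hg, ha⟩, hn⟩ := ((ht.eventually eventually_diag).and (eventually_gt_atTop 0)).exists
  have hν : 1 ≤ μ ^ (1 / (n : ℝ)) := Real.one_le_rpow hμ.le (by positivity)
  rw [Real.sq_sqrt (by linarith)] at ha
  have hνn : (μ ^ (1 / (n : ℝ))) ^ n = μ := by
    rw [one_div]; exact Real.rpow_inv_natCast_pow (by positivity) hn.ne'
  generalize μ ^ (1 / (n : ℝ)) = ν at *
  rw [show 1 + (ν - 1) = ν by ring] at ha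
  refine ⟨g ^ n, hg.pow n, ?_⟩
  rw [← hνn]
  clear hνn hn
  induction n with
  | zero => 
    intro p _
    exact ⟨1, one_pos, by simp [mat_apply]⟩
  | succ n ih =>
    rw [pow_succ]
    intro p hp
    obtain ⟨t, ht, e⟩ := ih.mul ha hg p hp
    refine ⟨t, ht, ?_⟩
    rw [← e]
    simp [mat_apply]; ring

lemma exists_diag' {μ : ℝ} (hμ : 1 < μ) : ∃ g : Equiv.Perm (ℝ × ℝ), Good g 0 ∧
    Acts g (mat 1 0 0 μ) ∧ Acts g⁻¹ (mat μ 0 0 1) := by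
  obtain ⟨g, h1, h2⟩ := exists_diag hμ
  refine ⟨g, h1, h2, h2.inv h1 (by linarith : 0 < μ) ?_⟩
  intro p; simp [mat_apply]; ext <;> simp

lemma acts_eq {g h : Equiv.Perm (ℝ × ℝ)} {A B : (ℝ × ℝ) →ₗ[ℝ] (ℝ × ℝ)} {c d r : ℝ}
    (hg : Acts g A) (hh : Acts h B) (gg : Good g c) (gh : Good h d) (hr : 0 < r)
    (hAB : ∀ p, A p = r • B p) {p : ℝ × ℝ} (hp : p ∈ bdry) : g p = h p := by
  obtain ⟨t, ht, e⟩ := hg p hp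
  obtain ⟨s, hs, e'⟩ := hh p hp
  have h1 := hAB p
  rw [e, e'] at h1
  have g1 : (g p).1 ^ 2 + (g p).2 ^ 2 = 1 := gg.bd hp
  have g2 : (h p).1 ^ 2 + (h p).2 ^ 2 = 1 := gh.bd hp
  have x1 : t * (g p).1 = r * s * (h p).1 := by
    have := congrArg Prod.fst h1; simpa [mul_assoc] using this
  have x2 : t * (g p).2 = r * s * (h p).2 := by
    have := congrArg Prod.snd h1; simpa [mul_assoc] using this
  have x3 : t ^ 2 = (r * s) ^ 2 := by
    calc t ^ 2 = (t * (g p).1) ^ 2 + (t * (g p).2) ^ 2 := by linear_combination -t ^ 2 * g1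
      _ = (r * s) ^ 2 := by rw [x1, x2]; linear_combination (r * s) ^ 2 * g2
  have x4 : t = r * s := by
    have := mul_pos hr hs
    nlinarith
  rw [← x4] at x1 x2
  ext
  · exact mul_left_cancel₀ ht.ne' x1
  · exact mul_left_cancel₀ ht.ne' x2

lemma rotE_pow (a : ℝ) (n : ℕ) : rotE a ^ n = rotE (n * a) := by
  induction n with
  | zero => ext p <;> simp [rotE_apply, rot_zero]
  | succ n ih =>
    rw [pow_succ, ih]
    apply Equiv.ext
    intro p
    rw [Equiv.Perm.mul_apply, rotE_apply, rotE_apply, rotE_apply, rot_rot]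
    congr 1; push_cast; ring


/-- the flux homomorphism cannot be extended from `G_{o,rel}` to a
group homomorphism on `G_o`: there is no `Φ : G_o → ℝ` additive under
composition whose value on boundary-fixing elements is `σ = Flux_ℝ`. -/
theorem flux_has_no_homomorphism_extension :
    ¬ ∃ Φ : (ℝ × ℝ → ℝ × ℝ) → ℝ,
        (∀ g h : ℝ × ℝ → ℝ × ℝ, IsSympO g → IsSympO h →
          Φ (g ∘ h) = Φ g + Φ h) ∧
        (∀ h : ℝ × ℝ → ℝ × ℝ, IsSympO h → (∀ p ∈ bdry, h p = p) →
          Φ h = sigmaQ h) := by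
  rintro ⟨Φ, hadd, hrel⟩
  have hmul : ∀ {g h : Equiv.Perm (ℝ × ℝ)} {c d : ℝ}, Good g c → Good h d →
      Φ (g * h : Equiv.Perm (ℝ × ℝ)) = Φ g + Φ h := fun hg hh => hadd _ _ hg.isSympO hh.isSympO
  have hone : Φ (1 : Equiv.Perm (ℝ × ℝ)) = 0 := by
    have := hmul good_one good_one
    rw [mul_one] at this
    linarith
  have hinv : ∀ {g : Equiv.Perm (ℝ × ℝ)} {c : ℝ}, Good g c → 
      Φ (g⁻¹ : Equiv.Perm (ℝ × ℝ)) = - Φ g := by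
    intro g c hg
    have := hmul hg hg.inv
    rw [mul_inv_cancel, hone] at this
    linarith
  have hpow : ∀ (a : ℝ) (n : ℕ), Φ (rotE (n * a)) = n * Φ (rotE a) := by
    intro a n
    induction n with
    | zero =>
      have : rotE ((0 : ℕ) * a) = 1 := by rw [← rotE_pow, pow_zero]
      rw [this, hone]; simp
    | succ n ih =>
      rw [← rotE_pow, pow_succ, rotE_pow, hmul (good_rot _) (good_rot _), ih]
      push_cast; ring
  have hr : ∀ n : ℕ, Φ (rotE (n * (π / 12))) = 0 := by
    intro n
    have h24 : rotE ((24 : ℕ) * (π / 12)) = 1 := by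
      apply Equiv.ext
      intro p
      rw [rotE_apply, show ((24 : ℕ) : ℝ) * (π / 12) = 2 * π by push_cast; ring]
      simp [rot]
    have := hpow (π / 12) 24
    rw [h24, hone] at this
    rw [hpow]
    have : Φ (rotE (π / 12)) = 0 := by push_cast at this; linarith
    rw [this, mul_zero]
  have r1 : Φ (rotE (π / 4)) = 0 := by
    have := hr 3
    rwa [show ((3 : ℕ) : ℝ) * (π / 12) = π / 4 by push_cast; ring] at this
  have r2 : Φ (rotE (π / 6)) = 0 := by
    have := hr 2
    rwa [show ((2 : ℕ) : ℝ) * (π / 12) = π / 6 by push_cast; ring] at this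
  have r3 : Φ (rotE (π - π / 4)) = 0 := by
    have := hr 9
    rwa [show ((9 : ℕ) : ℝ) * (π / 12) = π - π / 4 by push_cast; ring] at this
  have q2 : √2 ^ 2 = 2 := Real.sq_sqrt (by norm_num)
  have q3 : √3 ^ 2 = 3 := Real.sq_sqrt (by norm_num)
  have p2 : 0 < √2 := by positivity
  have p3 : 0 < √3 := by positivity
  have p3' : 1 < √3 := by nlinarith
  have hμ : 1 < √2 + 1 := by linarith
  have hn : 1 < (√3 + 1) * √2 / 2 := by nlinarith
  obtain ⟨h, gh, ah, ah'⟩ := exists_diag' hμ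
  obtain ⟨k, gk, ak, ak'⟩ := exists_diag' hn
  have A1 := acts_rot (π / 4) p2
  have A2 := acts_rot (π / 6) (two_pos : (0 : ℝ) < 2)
  have A3 := acts_rot (π - π / 4) p2
  rw [cos_pi_div_four, sin_pi_div_four, show √2 * (√2 / 2) = 1 by linear_combination q2 / 2] at A1
  rw [cos_pi_div_six, sin_pi_div_six, show 2 * (√3 / 2) = √3 by ring,
    show (2 : ℝ) * (1 / 2) = 1 by norm_num] at A2
  rw [cos_pi_sub, sin_pi_sub, cos_pi_div_four, sin_pi_div_four,
    show √2 * (√2 / 2) = 1 by linear_combination q2 / 2,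
    show √2 * -(√2 / 2) = -1 by linear_combination -q2 / 2] at A3
  have G1 := good_rot (π / 4)
  have G2 := good_rot (π / 6)
  have G3 := good_rot (π - π / 4)
  have GX := G1.mul (gh.inv.mul (G2.mul (gh.mul G1)))
  have AX := A1.mul (ah'.mul (A2.mul (ah.mul A1 G1) (gh.mul G1)) (G2.mul (gh.mul G1)))
    (gh.inv.mul (G2.mul (gh.mul G1)))
  have GY := gk.inv.mul (G3.mul gk)
  have AY := ak'.mul (A3.mul ak gk) (G3.mul gk)
  have hXY := fun (p : ℝ × ℝ) (hp : p ∈ bdry) => acts_eq AX AY GX GY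
    (r := 2 * (√2 + 1) * (√3 - 1)) (mul_pos (by positivity) (by linarith)) (by
      intro p
      simp only [LinearMap.comp_apply, mat_apply]
      ext
      · simp only [Prod.smul_fst, smul_eq_mul]
        linear_combination p.1 * ((√2 ^ 2 + √2) * q3 + q2) +
          p.2 * ((√2 + 1) * (√3 + 1) / 2 * (√2 ^ 2 * q3 + 2 * q2) - q2)
      · simp only [Prod.smul_snd, smul_eq_mul]
        linear_combination p.1 * (-q2) + p.2 * ((√2 ^ 2 + √2) * q3 + q2)) hp
  have GW := GY.inv.mul GX
  have fx : ∀ p ∈ bdry, ((k⁻¹ * (rotE (π - π / 4) * k))⁻¹ *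
      (rotE (π / 4) * (h⁻¹ * (rotE (π / 6) * (h * rotE (π / 4))))) : Equiv.Perm (ℝ × ℝ)) p = p := by
    intro p hp
    rw [Equiv.Perm.mul_apply, hXY p hp]
    exact Equiv.symm_apply_apply _ p
  have s1 := hrel _ GW.isSympO fx
  obtain ⟨m, hm⟩ := GW.sigma (fx (1, 0) (by simp [bdry]))
  rw [← s1, hmul GY.inv GX, hinv GY, hmul gk.inv (G3.mul gk), hmul G3 gk, hinv gk,
    hmul G1 (gh.inv.mul (G2.mul (gh.mul G1))), hmul gh.inv (G2.mul (gh.mul G1)),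
    hmul G2 (gh.mul G1), hmul gh G1, hinv gh, r1, r2, r3] at hm
  have hm' : (0 : ℝ) = π * (1 + 24 * m) := by linarith
  have h0 : (1 + 24 * m : ℝ) = 0 := by
    rcases mul_eq_zero.1 hm'.symm with h | h
    · exact absurd h pi_ne_zero
    · exact h
  have : (1 + 24 * m : ℤ) = 0 := by exact_mod_cast h0
  omega
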